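/- arXiv:1811.12871 — 2 statements merged into one kernel-verified Lean document; each statement's English description precedes it below -/
import Mathlib

section
/- Let R be a commutative ring, M a finite free R-module, f : M →ₗ[R] M a linear endomorphism, and n ≥ 1. Consider the n-fold tensor power ⨂_{i ∈ Fin n} M (the PiTensorProduct over R) and the linear endomorphism Φ determined on pure tensors by Φ(x_1 ⊗ x_2 ⊗ ⋯ ⊗ x_n) = f(x_n) ⊗ f(x_1) ⊗ ⋯ ⊗ f(x_{n-1}) (the Fuller construction of f). Then the trace of Φ equals the trace of the n-th iterate of f: LinearMap.trace R (⨂ⁿ M) Φ = LinearMap.trace R M (f^n). -/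
open scoped TensorProduct

/-- Summing the weights of all walks `p` of length `m`, with an additional factor depending on
the endpoints, amounts to pairing that factor with the entries of the `m`-th matrix power. -/
theorem Matrix.sum_walk_weight_eq_sum_pow {R κ : Type*} [CommSemiring R] [Fintype κ]
    [DecidableEq κ] (A : Matrix κ κ R) (m : ℕ) (g : κ → κ → R) :
    ∑ p : Fin (m + 1) → κ,
      g (p 0) (p (Fin.last m)) * ∏ i : Fin m, A (p i.succ) (p i.castSucc) =
    ∑ b, ∑ a, g b a * (A ^ m) a b := by
  induction m generalizing g with
  | zero =>
    rw [← (Equiv.funUnique (Fin 1) κ).symm.sum_comp]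
    simp [Matrix.one_apply]
  | succ m ih =>
    rw [← (Fin.consEquiv fun _ : Fin (m + 2) => κ).sum_comp, Fintype.sum_prod_type,
      Finset.sum_comm]
    have h := ih fun c a => ∑ x, g x a * A c x
    simp only [Finset.sum_mul] at h
    calc
      _ = _ := by
        refine Finset.sum_congr rfl fun q _ => Finset.sum_congr rfl fun x _ => ?_
        simp only [Fin.consEquiv_apply, Fin.prod_univ_succ, Fin.cons_zero, Fin.cons_succ,
          Fin.castSucc_zero, ← Fin.succ_last, ← Fin.succ_castSucc]
        rw [← mul_assoc]
      _ = _ := h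
      _ = _ := by
        simp only [pow_succ, Matrix.mul_apply, Finset.mul_sum]
        refine Finset.sum_comm.trans (Eq.trans ?_ Finset.sum_comm)
        refine Finset.sum_congr rfl fun a _ => Finset.sum_comm.trans ?_
        refine Finset.sum_congr rfl fun x _ => Finset.sum_congr rfl fun c _ => ?_
        ring

/-- The trace of `A ^ n` is the total weight of the closed walks of length `n`. -/
theorem Matrix.trace_pow_eq_sum_prod {R κ : Type*} [CommSemiring R] [Fintype κ]
    [DecidableEq κ] (A : Matrix κ κ R) (n : ℕ) [NeZero n] :
    (A ^ n).trace = ∑ p : Fin n → κ, ∏ i, A (p i) (p (i - 1)) := by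
  obtain ⟨m, rfl⟩ := Nat.exists_eq_succ_of_ne_zero (NeZero.ne n)
  have h_zero : (0 : Fin (m + 1)) - 1 = Fin.last m := by
    ext
    simp [Fin.coe_neg_one]
  have h_succ (i : Fin m) : i.succ - 1 = i.castSucc := by
    rw [sub_eq_iff_eq_add, Fin.coeSucc_eq_succ]
  simp only [Nat.succ_eq_add_one, Fin.prod_univ_succ, h_zero, h_succ]
  rw [A.sum_walk_weight_eq_sum_pow m A, pow_succ']
  simp only [Matrix.trace, Matrix.diag_apply, Matrix.mul_apply]

/-- **Trace of the Fuller construction on tensor powers.**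
Let `M` be a finite free module over a commutative ring `R`, `f : M →ₗ[R] M`, and
`n ≥ 1` (encoded as `[NeZero n]`).  If `Φ` is the endomorphism of the `n`-fold
tensor power `⨂[R] (i : Fin n), M` determined on pure tensors by
`Φ (x₁ ⊗ ⋯ ⊗ xₙ) = f xₙ ⊗ f x₁ ⊗ ⋯ ⊗ f xₙ₋₁` (i.e. slot `i` of the output is
`f` applied to slot `i - 1`, indices mod `n`), then `trace Φ = trace (f ^ n)`. -/
theorem trace_fuller_tensor_power
    {R : Type*} [CommRing R]
    {M : Type*} [AddCommGroup M] [Module R M]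
    [Module.Finite R M] [Module.Free R M]
    (f : M →ₗ[R] M) (n : ℕ) [NeZero n]
    (Φ : (⨂[R] (_ : Fin n), M) →ₗ[R] ⨂[R] (_ : Fin n), M)
    (hΦ : ∀ x : Fin n → M,
      Φ (PiTensorProduct.tprod R x) = PiTensorProduct.tprod R (fun i => f (x (i - 1)))) :
    LinearMap.trace R (⨂[R] (_ : Fin n), M) Φ = LinearMap.trace R M (f ^ n) := by
  classical
  let b := Module.Free.chooseBasis R M
  rw [LinearMap.trace_eq_matrix_trace R b, ← LinearMap.toMatrix_pow,
    Matrix.trace_pow_eq_sum_prod,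
    LinearMap.trace_eq_matrix_trace R (Basis.piTensorProduct fun _ : Fin n => b)]
  simp [Matrix.trace, LinearMap.toMatrix_apply, hΦ]
end

section
/- Let R be a commutative ring, let M and N be finite free R-modules, and let f : M →ₗ[R] N and g : N →ₗ[R] M be linear maps. Let Φ be the linear endomorphism of M ⊗[R] N determined on pure tensors by Φ(m ⊗ n) = g(n) ⊗ f(m). Then LinearMap.trace R (M ⊗ N) Φ = LinearMap.trace R M (g ∘ f), which also equals LinearMap.trace R N (f ∘ g). -/
open TensorProduct

/-- **Trace of the 2-fold Fuller construction.**
Let `M`, `N` be finite free modules over a commutative ring `R`, and let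
`f : M →ₗ[R] N` and `g : N →ₗ[R] M`.  If `Φ` is the endomorphism of `M ⊗[R] N`
determined on pure tensors by `Φ (m ⊗ₜ n) = g n ⊗ₜ f m`, then
`trace Φ = trace (g ∘ₗ f)`, which equals `trace (f ∘ₗ g)`. -/
theorem trace_fuller_two
    {R : Type*} [CommRing R]
    {M N : Type*} [AddCommGroup M] [Module R M] [AddCommGroup N] [Module R N]
    [Module.Finite R M] [Module.Free R M] [Module.Finite R N] [Module.Free R N]
    (f : M →ₗ[R] N) (g : N →ₗ[R] M)
    (Φ : M ⊗[R] N →ₗ[R] M ⊗[R] N)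
    (hΦ : ∀ (m : M) (n : N), Φ (m ⊗ₜ[R] n) = g n ⊗ₜ[R] f m) :
    LinearMap.trace R (M ⊗[R] N) Φ = LinearMap.trace R M (g ∘ₗ f) ∧
      LinearMap.trace R M (g ∘ₗ f) = LinearMap.trace R N (f ∘ₗ g) := by
  classical
  refine ⟨?_, LinearMap.trace_comp_comm' f g⟩
  let b := Module.Free.chooseBasis R M
  let c := Module.Free.chooseBasis R N
  rw [LinearMap.trace_eq_matrix_trace R (b.tensorProduct c),
    LinearMap.trace_eq_matrix_trace R b, LinearMap.toMatrix_comp b c b]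
  simp [Matrix.trace, Matrix.mul_apply, LinearMap.toMatrix_apply, Fintype.sum_prod_type, hΦ,
    mul_comm]
end
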